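/- arXiv:2308.00561 — 3 statements merged into one kernel-verified Lean document; each statement's English description precedes it below -/
import Mathlib

section
/- Let n ≥ 2 and let A ∈ ℂ^{n×n} be a matrix which is not a scalar multiple of the identity. Then there exists a Hermitian matrix B ∈ ℂ^{n×n} (B* = B) such that the unital subalgebra of ℂ^{n×n} generated by A and B is all of ℂ^{n×n}. -/
open Matrix

/-- The nilpotent matrix with ones just below the diagonal. -/
def Matrix.lowerShift (m : ℕ) : Matrix (Fin (m + 1)) (Fin (m + 1)) ℂ :=
  Matrix.of fun i j => if i.val = j.val + 1 then 1 else 0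

theorem Matrix.lowerShift_apply (m : ℕ) (i j : Fin (m + 1)) :
    lowerShift m i j = if i.val = j.val + 1 then 1 else 0 := rfl

theorem Matrix.lowerShift_pow_apply (m k : ℕ) (i j : Fin (m + 1)) :
    (lowerShift m ^ k) i j = if i.val = j.val + k then 1 else 0 := by
  induction k generalizing i with
  | zero => simp [Matrix.one_apply, Fin.ext_iff]
  | succ k ih =>
    rw [pow_succ', Matrix.mul_apply]
    simp only [ih, lowerShift_apply, mul_ite, mul_one, mul_zero]
    by_cases h : i.val = j.val + (k + 1)
    · rw [if_pos h, Finset.sum_eq_single (⟨j.val + k, by omega⟩ : Fin (m + 1))]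
      · simp [h, add_assoc]
      · intro b _ hb
        rw [if_neg]
        exact fun h' => hb (Fin.ext h')
      · simp
    · rw [if_neg h]
      refine Finset.sum_eq_zero fun b _ => ?_
      split_ifs <;> first | rfl | omega

/-- A subalgebra containing all matrix units is everything. -/
theorem Matrix.subalgebra_eq_top_of_single_mem {ι : Type*} [Fintype ι] [DecidableEq ι]
    (S : Subalgebra ℂ (Matrix ι ι ℂ)) (h : ∀ i j, single i j (1 : ℂ) ∈ S) : S = ⊤ := by
  refine eq_top_iff.2 fun X _ => ?_
  rw [matrix_eq_sum_single X]
  refine sum_mem fun i _ => sum_mem fun j _ => ?_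
  simpa [smul_single] using S.smul_mem (h i j) (X i j)

theorem Matrix.adjoin_lowerShift_eq_top {m : ℕ} (A : Matrix (Fin (m + 1)) (Fin (m + 1)) ℂ)
    (hA : ∀ i, A i (Fin.last m) = if i = 0 then 1 else 0) :
    Algebra.adjoin ℂ ({A, lowerShift m} : Set (Matrix (Fin (m + 1)) (Fin (m + 1)) ℂ)) = ⊤ := by
  set S := Algebra.adjoin ℂ ({A, lowerShift m} : Set (Matrix (Fin (m + 1)) (Fin (m + 1)) ℂ))
  have hAS : A ∈ S := Algebra.subset_adjoin (by simp)
  have hLS (k : ℕ) : lowerShift m ^ k ∈ S := pow_mem (Algebra.subset_adjoin (by simp)) k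
  have hcol (i : Fin (m + 1)) : single i 0 (1 : ℂ) ∈ S := by
    have hprod : lowerShift m ^ i.val * (A * lowerShift m ^ m) = single i 0 1 := by
      have hlast : lowerShift m ^ m = single (Fin.last m) 0 1 := by
        ext a b
        rw [lowerShift_pow_apply, single_apply]
        simp only [Fin.ext_iff, Fin.val_last, Fin.val_zero]
        have := a.isLt
        congr 1
        apply propext
        omega
      have hzero : A * single (Fin.last m) 0 1 = single 0 0 1 := by
        ext a b
        by_cases hb : b = 0
        · subst hb
          rw [mul_single_apply_same, hA, single_apply]
          simp [eq_comm]
        · rw [mul_single_apply_of_ne _ _ _ _ _ hb, single_apply]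
          simp [Ne.symm hb]
      rw [hlast, hzero]
      ext a b
      by_cases hb : b = 0
      · subst hb
        rw [mul_single_apply_same, lowerShift_pow_apply, single_apply]
        simp [Fin.ext_iff, eq_comm]
      · rw [mul_single_apply_of_ne _ _ _ _ _ hb, single_apply]
        simp [Ne.symm hb]
    rw [← hprod]
    exact mul_mem (hLS _) (mul_mem hAS (hLS _))
  refine subalgebra_eq_top_of_single_mem S fun i j => ?_
  induction j using WellFoundedLT.induction with
  | ind j ih =>
    set Y := A * lowerShift m ^ (m - j.val) with hY
    have hYj : Y 0 j = 1 := by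
      rw [hY, Matrix.mul_apply, Finset.sum_eq_single (Fin.last m)]
      · rw [lowerShift_pow_apply, hA, if_pos rfl, if_pos, one_mul]
        have := j.isLt
        simp only [Fin.val_last]
        omega
      · intro b _ hb
        rw [lowerShift_pow_apply, if_neg, mul_zero]
        intro h
        apply hb
        ext
        have := j.isLt
        simp only [Fin.val_last]
        omega
      · simp
    have hYgt (b : Fin (m + 1)) (hb : j < b) : Y 0 b = 0 := by
      rw [hY, Matrix.mul_apply]
      refine Finset.sum_eq_zero fun c _ => ?_
      rw [lowerShift_pow_apply, if_neg, mul_zero]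
      have := c.isLt
      have : j.val < b.val := hb
      omega
    have hrow : single i j (1 : ℂ) =
        single i 0 1 * Y - ∑ b ∈ Finset.univ.filter (· < j), Y 0 b • single i b (1 : ℂ) := by
      ext a c
      rw [Matrix.sub_apply, Matrix.sum_apply]
      by_cases ha : a = i
      · subst ha
        rw [single_mul_apply_same, one_mul]
        simp only [Matrix.smul_apply, single_apply, true_and, smul_eq_mul, mul_ite, mul_one,
          mul_zero, Finset.sum_ite_eq', Finset.mem_filter, Finset.mem_univ]
        rcases lt_trichotomy c j with h | h | h
        · simp [h, h.ne']
        · simp [h, hYj]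
        · simp [h.not_gt, h.ne, hYgt c h]
      · rw [single_mul_apply_of_ne _ _ _ _ _ ha]
        simp [Ne.symm ha]
    rw [hrow]
    refine sub_mem (mul_mem (hcol i) (mul_mem hAS (hLS _))) (sum_mem fun b hb => ?_)
    exact S.smul_mem (ih b (by simpa using hb)) _

/-- Two linearly independent vectors occur at two prescribed places of some basis. -/
theorem exists_basis_apply_eq_of_linearIndependent_pair {ι V : Type*} [Fintype ι]
    [AddCommGroup V] [Module ℂ V] [FiniteDimensional ℂ V]
    (hι : Fintype.card ι = Module.finrank ℂ V) {p q : ι} (hpq : p ≠ q) {v w : V}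
    (h : LinearIndependent ℂ ![v, w]) : ∃ b : Module.Basis ι ℂ V, b p = v ∧ b q = w := by
  classical
  let b₀ := Module.Basis.sumExtend h
  have hb₀ (k : Fin 2) : b₀ (Sum.inl k) = ![v, w] k := by
    simp [b₀, Module.Basis.sumExtend]
    rfl
  let e := b₀.indexEquiv ((Module.finBasis ℂ V).reindex
    (Fintype.equivFinOfCardEq hι).symm)
  have htrans : MulAction.IsMultiplyPretransitive (Equiv.Perm ι) ι 2 :=
    Equiv.Perm.isMultiplyPretransitive ι 2
  obtain ⟨σ, h₀, h₁⟩ := MulAction.is_two_pretransitive_iff.1 htrans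
    (show e (Sum.inl 0) ≠ e (Sum.inl 1) by simp) hpq
  refine ⟨b₀.reindex (e.trans σ), ?_, ?_⟩
  · rw [Module.Basis.reindex_apply, ← h₀]
    simp [hb₀]
  · rw [Module.Basis.reindex_apply, ← h₁]
    simp [hb₀]

/-- A non-scalar matrix generates the full matrix algebra together with some other matrix. -/
theorem Matrix.exists_adjoin_pair_eq_top {n : ℕ} (hn : 2 ≤ n)
    (A : Matrix (Fin n) (Fin n) ℂ)
    (hA : ¬ ∃ c : ℂ, A = c • (1 : Matrix (Fin n) (Fin n) ℂ)) :
    ∃ B : Matrix (Fin n) (Fin n) ℂ,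
      Algebra.adjoin ℂ ({A, B} : Set (Matrix (Fin n) (Fin n) ℂ)) = ⊤ := by
  obtain ⟨m, rfl⟩ : ∃ m, n = m + 1 := ⟨n - 1, by omega⟩
  obtain ⟨v, hv⟩ : ∃ v, LinearIndependent ℂ ![v, toLinAlgEquiv' A v] := by
    by_contra! h
    obtain ⟨c, hc⟩ := LinearMap.exists_eq_smul_id_of_forall_notLinearIndependent h
    refine hA ⟨c, toLinAlgEquiv'.injective ?_⟩
    rw [hc, map_smul, map_one]
  obtain ⟨b, hb₁, hb₂⟩ := exists_basis_apply_eq_of_linearIndependent_pair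
    (by simp) (show Fin.last m ≠ 0 by simp [Fin.ext_iff]; omega) hv
  let e : Matrix (Fin (m + 1)) (Fin (m + 1)) ℂ ≃ₐ[ℂ] Matrix (Fin (m + 1)) (Fin (m + 1)) ℂ :=
    toLinAlgEquiv'.trans (LinearMap.toMatrixAlgEquiv b)
  have he := adjoin_lowerShift_eq_top (e A) fun i => by
    simp only [e, AlgEquiv.trans_apply, LinearMap.toMatrixAlgEquiv_apply]
    rw [hb₁, ← hb₂, Module.Basis.repr_self, Finsupp.single_apply]
    simp [eq_comm]
  refine ⟨e.symm (lowerShift m), ?_⟩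
  have hmap := congrArg (Subalgebra.map e.symm.toAlgHom) he
  rw [AlgHom.map_adjoin, Set.image_pair, Algebra.map_top,
    (AlgHom.range_eq_top _).2 e.symm.surjective] at hmap
  simpa using hmap

open Polynomial in
/-- If the pencil `X + i Y` generates the full matrix algebra together with `A`, then so does
`X + t Y` for some real `t`. -/
theorem Matrix.exists_real_adjoin_eq_top {ι : Type*} [Fintype ι] [DecidableEq ι]
    (A X Y : Matrix ι ι ℂ)
    (h : Algebra.adjoin ℂ ({A, X + Complex.I • Y} : Set (Matrix ι ι ℂ)) = ⊤) :
    ∃ t : ℝ, Algebra.adjoin ℂ ({A, X + (t : ℂ) • Y} : Set (Matrix ι ι ℂ)) = ⊤ := by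
  let pencil : Fin 2 → Matrix ι ι ℂ[X] := ![A.map C, X.map C + (Polynomial.X : ℂ[X]) • Y.map C]
  let ev (t : ℂ) : Matrix ι ι ℂ[X] →ₐ[ℂ] Matrix ι ι ℂ := (aeval t).mapMatrix
  have hev (t : ℂ) (F : FreeAlgebra ℂ (Fin 2)) : ev t (FreeAlgebra.lift ℂ pencil F) =
      FreeAlgebra.lift ℂ ![A, X + t • Y] F := by
    rw [← AlgHom.comp_apply]
    congr 1
    ext k : 2
    fin_cases k
    · ext i j
      simp [ev, pencil]
    · ext i j
      simp [ev, pencil, mul_comm t]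
  have hrange (t : ℂ) : Algebra.adjoin ℂ ({A, X + t • Y} : Set (Matrix ι ι ℂ)) =
      (FreeAlgebra.lift ℂ ![A, X + t • Y]).range := by
    rw [← Algebra.adjoin_range_eq_range_freeAlgebra_lift]
    simp [Set.pair_comm]
  have hsurj (p : ι × ι) : ∃ F : FreeAlgebra ℂ (Fin 2),
      FreeAlgebra.lift ℂ ![A, X + Complex.I • Y] F = single p.1 p.2 1 := by
    have : single p.1 p.2 (1 : ℂ) ∈ (FreeAlgebra.lift ℂ ![A, X + Complex.I • Y]).range := by
      rw [← hrange, h]; trivial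
    exact this
  choose F hF using hsurj
  let M : Matrix (ι × ι) (ι × ι) ℂ[X] :=
    Matrix.of fun p q => FreeAlgebra.lift ℂ pencil (F p) q.1 q.2
  have hM (t : ℂ) (p q : ι × ι) : (aeval t).mapMatrix M p q =
      FreeAlgebra.lift ℂ ![A, X + t • Y] (F p) q.1 q.2 := by
    rw [← hev]
    rfl
  have hdet (t : ℂ) : ((aeval t).mapMatrix M).det = M.det.eval t := by
    rw [← AlgHom.map_det, coe_aeval_eq_eval]
  have hdet_ne : M.det ≠ 0 := by
    intro h0
    have h1 : (aeval Complex.I).mapMatrix M = 1 := by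
      ext p q
      rw [hM, hF, single_apply, Matrix.one_apply]
      simp [Prod.ext_iff]
    have := hdet Complex.I
    simp [h1, h0] at this
  obtain ⟨t, ht⟩ : ∃ t : ℝ, M.det.eval (t : ℂ) ≠ 0 := by
    by_contra! hall
    refine hdet_ne (Polynomial.eq_zero_of_infinite_isRoot _ ?_)
    exact (Set.infinite_range_of_injective Complex.ofReal_injective).mono
      (by rintro _ ⟨t, rfl⟩; exact hall t)
  refine ⟨t, subalgebra_eq_top_of_single_mem _ fun i j => ?_⟩
  set N := (aeval (t : ℂ)).mapMatrix M with hN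
  have hinv : N⁻¹ * N = 1 := nonsing_inv_mul _ (by rw [hN, hdet]; exact ht.isUnit)
  have hcomb : single i j (1 : ℂ) =
      ∑ p, N⁻¹ (i, j) p • FreeAlgebra.lift ℂ ![A, X + (t : ℂ) • Y] (F p) := by
    ext k l
    have := congrFun (congrFun hinv (i, j)) (k, l)
    rw [Matrix.mul_apply, Matrix.one_apply] at this
    simp only [hN, hM] at this
    rw [Matrix.sum_apply, single_apply]
    simp only [Matrix.smul_apply, smul_eq_mul, hN, this]
    simp [Prod.ext_iff]
  rw [hrange, hcomb]
  exact sum_mem fun p _ => Subalgebra.smul_mem _ (AlgHom.mem_range_self _ (F p)) _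



/-- If `A ∈ ℂ^{n×n}` (`n ≥ 2`) is not a scalar multiple of the identity,
then there is a Hermitian matrix `B` such that the unital subalgebra generated by `A` and `B`
is all of `ℂ^{n×n}`. -/
theorem generate_matrix_algebra {n : ℕ} (hn : 2 ≤ n)
    (A : Matrix (Fin n) (Fin n) ℂ)
    (hA : ¬ ∃ c : ℂ, A = c • (1 : Matrix (Fin n) (Fin n) ℂ)) :
    ∃ B : Matrix (Fin n) (Fin n) ℂ, B.IsHermitian ∧
      Algebra.adjoin ℂ ({A, B} : Set (Matrix (Fin n) (Fin n) ℂ)) = ⊤ := by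
  obtain ⟨B, hB⟩ := Matrix.exists_adjoin_pair_eq_top hn A hA
  rw [← realPart_add_I_smul_imaginaryPart B] at hB
  obtain ⟨t, ht⟩ := Matrix.exists_real_adjoin_eq_top A _ _ hB
  refine ⟨_, ?_, ht⟩
  exact (realPart B).2.add (IsSelfAdjoint.smul (Complex.conj_ofReal t) (imaginaryPart B).2)
end

section
/- Let K, K' ∈ ℂ^{n×n} and let V_1, …, V_r, V'_1, …, V'_s ∈ ℂ^{n×n}. If Σ_{k=1}^r V_k X V_k* − KX − XK* = Σ_{k=1}^s V'_k X (V'_k)* − K'X − X(K')* for every X ∈ ℂ^{n×n}, then the unital subalgebra of ℂ^{n×n} generated by {V_1, …, V_r} equals the unital subalgebra generated by {V'_1, …, V'_s}. (The relaxation algebra of a generator of a completely positive dynamical semigroup is well-defined, independent of the chosen representation.) -/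
open Matrix

open scoped ComplexConjugate

/-- A linear functional on matrices is determined by its values on the matrix units. -/
lemma Matrix.linearMap_apply_eq_sum_single {n : ℕ}
    (φ : Matrix (Fin n) (Fin n) ℂ →ₗ[ℂ] ℂ) (A : Matrix (Fin n) (Fin n) ℂ) :
    φ A = ∑ i, ∑ a, A i a * φ (Matrix.single i a 1) := by
  conv_lhs => rw [Matrix.matrix_eq_sum_single A]
  simp only [map_sum]
  refine Finset.sum_congr rfl fun i _ => Finset.sum_congr rfl fun a _ => ?_
  rw [← smul_eq_mul, ← map_smul, Matrix.smul_single, smul_eq_mul, mul_one]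

/-- The contraction of a superoperator `F` against the sesquilinear form of `φ`. On
`X ↦ A * X * Bᴴ` it takes the value `φ A * conj (φ B)`. -/
noncomputable def superoperatorContraction {n : ℕ} (φ : Matrix (Fin n) (Fin n) ℂ →ₗ[ℂ] ℂ) :
    (Matrix (Fin n) (Fin n) ℂ → Matrix (Fin n) (Fin n) ℂ) →+ ℂ where
  toFun F := ∑ i, ∑ a, ∑ j, ∑ b, F (Matrix.single a b 1) i j *
    (φ (Matrix.single i a 1) * conj (φ (Matrix.single j b 1)))
  map_zero' := by simp
  map_add' F G := by simp [add_mul, Finset.sum_add_distrib]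

lemma superoperatorContraction_mul_conjTranspose {n : ℕ}
    (φ : Matrix (Fin n) (Fin n) ℂ →ₗ[ℂ] ℂ) (A B : Matrix (Fin n) (Fin n) ℂ) :
    superoperatorContraction φ (fun X => A * X * Bᴴ) = φ A * conj (φ B) := by
  have entry (i a j b : Fin n) :
      (A * Matrix.single a b (1 : ℂ) * Bᴴ) i j = A i a * conj (B j b) := by
    rw [Matrix.mul_apply, Finset.sum_eq_single b]
    · simp
    · intro c _ hc
      simp [Matrix.mul_single_apply_of_ne _ _ _ _ _ hc]
    · simp
  simp only [superoperatorContraction, AddMonoidHom.coe_mk, ZeroHom.coe_mk, entry]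
  rw [Matrix.linearMap_apply_eq_sum_single φ A, Matrix.linearMap_apply_eq_sum_single φ B]
  simp only [map_sum, map_mul, Finset.sum_mul]
  simp only [Finset.mul_sum]
  refine Finset.sum_congr rfl fun i _ => Finset.sum_congr rfl fun a _ =>
    Finset.sum_congr rfl fun j _ => Finset.sum_congr rfl fun b _ => ?_
  ring

lemma superoperatorContraction_generator {n r : ℕ}
    (φ : Matrix (Fin n) (Fin n) ℂ →ₗ[ℂ] ℂ) (h1 : φ 1 = 0) (K : Matrix (Fin n) (Fin n) ℂ)
    (V : Fin r → Matrix (Fin n) (Fin n) ℂ) :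
    superoperatorContraction φ (fun X => (∑ k, V k * X * (V k)ᴴ) - K * X - X * Kᴴ) =
      ∑ k, φ (V k) * conj (φ (V k)) := by
  have hF : (fun X => (∑ k, V k * X * (V k)ᴴ) - K * X - X * Kᴴ) =
      (∑ k, fun X => V k * X * (V k)ᴴ) - (fun X => K * X * 1ᴴ) - (fun X => 1 * X * Kᴴ) := by
    ext1 X
    simp
  rw [hF, map_sub, map_sub, map_sum]
  simp only [superoperatorContraction_mul_conjTranspose, h1, map_zero, mul_zero, zero_mul,
    sub_zero]

lemma adjoin_range_le_of_generator_eq {n r s : ℕ}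
    (K K' : Matrix (Fin n) (Fin n) ℂ)
    (V : Fin r → Matrix (Fin n) (Fin n) ℂ) (V' : Fin s → Matrix (Fin n) (Fin n) ℂ)
    (heq : ∀ X : Matrix (Fin n) (Fin n) ℂ,
      (∑ k, V k * X * (V k)ᴴ) - K * X - X * Kᴴ =
      (∑ k, V' k * X * (V' k)ᴴ) - K' * X - X * K'ᴴ) :
    Algebra.adjoin ℂ (Set.range V') ≤ Algebra.adjoin ℂ (Set.range V) := by
  rw [Algebra.adjoin_le_iff]
  rintro _ ⟨j, rfl⟩
  by_contra hj
  obtain ⟨φ, hφj, hφ⟩ := Submodule.exists_le_ker_of_notMem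
    (p := Subalgebra.toSubmodule (Algebra.adjoin ℂ (Set.range V))) hj
  have h1 : φ 1 = 0 := hφ (one_mem (Algebra.adjoin ℂ (Set.range V)))
  have hV (k : Fin r) : φ (V k) = 0 := hφ (Algebra.subset_adjoin (Set.mem_range_self k))
  have hsum := superoperatorContraction_generator φ h1 K V
  rw [funext heq, superoperatorContraction_generator φ h1 K' V'] at hsum
  simp only [hV, zero_mul, Finset.sum_const_zero, Complex.mul_conj] at hsum
  norm_cast at hsum
  rw [Finset.sum_eq_zero_iff_of_nonneg fun k _ => Complex.normSq_nonneg _] at hsum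
  exact hφj (Complex.normSq_eq_zero.mp (hsum j (Finset.mem_univ j)))

/-- If two representations `{K, V_k}` and `{K', V'_k}` define the same
generator `X ↦ Σ_k V_k X V_k* − KX − XK*` of a completely positive dynamical semigroup, then
the unital subalgebras generated by `{V_k}` and by `{V'_k}` coincide (the relaxation algebra
is well-defined). -/
theorem relaxation_algebra_well_defined {n r s : ℕ}
    (K K' : Matrix (Fin n) (Fin n) ℂ)
    (V : Fin r → Matrix (Fin n) (Fin n) ℂ) (V' : Fin s → Matrix (Fin n) (Fin n) ℂ)
    (heq : ∀ X : Matrix (Fin n) (Fin n) ℂ,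
      (∑ k, V k * X * (V k)ᴴ) - K * X - X * Kᴴ =
      (∑ k, V' k * X * (V' k)ᴴ) - K' * X - X * K'ᴴ) :
    Algebra.adjoin ℂ (Set.range V) = Algebra.adjoin ℂ (Set.range V') := by
  exact le_antisymm
    (adjoin_range_le_of_generator_eq K' K V' V fun X => (heq X).symm)
    (adjoin_range_le_of_generator_eq K K' V V' heq)
end

section
/- Let K, K' ∈ ℂ^{n×n} and let V_1, …, V_r, V'_1, …, V'_s ∈ ℂ^{n×n} all be traceless (tr V_k = 0 and tr V'_k = 0 for all k). If Σ_{k=1}^r V_k X V_k* − KX − XK* = Σ_{k=1}^s V'_k X (V'_k)* − K'X − X(K')* for every X ∈ ℂ^{n×n}, then there exists λ ∈ ℝ such that K' = K + iλ·𝟙, and moreover Σ_{k=1}^r V_k X V_k* = Σ_{k=1}^s V'_k X (V'_k)* for every X ∈ ℂ^{n×n}. -/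
open Matrix

/-- The partial trace of `X ↦ A X B` over the left factor is `tr A • B`. -/
lemma Matrix.sum_mul_single_mul_apply {ι R : Type*} [Fintype ι] [DecidableEq ι] [CommRing R]
    (A B : Matrix ι ι R) (b q : ι) :
    ∑ a, (A * Matrix.single a b 1 * B : Matrix ι ι R) a q = A.trace * B b q := by
  simp [Matrix.trace, Finset.sum_mul, Matrix.mul_apply, Matrix.single_apply, ite_and]

/-- The partial trace over the left factor of the generator `X ↦ Σ_k V_k X V_k* − KX − XK*` with
traceless `V_k`. -/
lemma Matrix.sum_generator_single_apply {ι κ : Type*} [Fintype ι] [DecidableEq ι] [Fintype κ]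
    (K : Matrix ι ι ℂ) (V : κ → Matrix ι ι ℂ) (htr : ∀ k, (V k).trace = 0) (b q : ι) :
    ∑ a, ((∑ k, V k * Matrix.single a b 1 * (V k)ᴴ) - K * Matrix.single a b 1
      - Matrix.single a b 1 * Kᴴ : Matrix ι ι ℂ) a q =
      -(K.trace * (1 : Matrix ι ι ℂ) b q) - (Fintype.card ι : ℂ) * Kᴴ b q := by
  have hV : ∑ a, (∑ k, V k * Matrix.single a b 1 * (V k)ᴴ : Matrix ι ι ℂ) a q = 0 := by
    simp only [Matrix.sum_apply]
    rw [Finset.sum_comm]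
    simp [Matrix.sum_mul_single_mul_apply, htr]
  have hK := Matrix.sum_mul_single_mul_apply K 1 b q
  have hK' := Matrix.sum_mul_single_mul_apply 1 Kᴴ b q
  rw [Matrix.trace_one] at hK'
  simp only [mul_one, one_mul] at hK hK'
  simp only [Matrix.sub_apply, Finset.sum_sub_distrib, hV, hK, hK', zero_sub]

/-- A matrix with `tr D • 𝟙 + n D* = 0` is an imaginary multiple of the identity. -/
lemma Matrix.exists_eq_imaginary_smul_one {ι : Type*} [Fintype ι] [DecidableEq ι]
    (D : Matrix ι ι ℂ)
    (h : ∀ b q, D.trace * (1 : Matrix ι ι ℂ) b q + (Fintype.card ι : ℂ) * Dᴴ b q = 0) :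
    ∃ lam : ℝ, D = ((lam : ℂ) * Complex.I) • (1 : Matrix ι ι ℂ) := by
  rcases isEmpty_or_nonempty ι with _ | _
  · exact ⟨0, Subsingleton.elim _ _⟩
  have hn : (Fintype.card ι : ℂ) ≠ 0 := Nat.cast_ne_zero.mpr Fintype.card_ne_zero
  obtain ⟨c, hc⟩ : ∃ c : ℂ, Dᴴ = c • (1 : Matrix ι ι ℂ) := by
    refine ⟨-D.trace / Fintype.card ι, ?_⟩
    ext b q
    rw [Matrix.smul_apply, smul_eq_mul, div_mul_eq_mul_div, eq_div_iff hn]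
    linear_combination h b q
  have hD : D = star c • (1 : Matrix ι ι ℂ) := by
    rw [← Matrix.conjTranspose_conjTranspose D, hc, Matrix.conjTranspose_smul,
      Matrix.conjTranspose_one]
  have hre : star c + c = 0 := by
    have i := Classical.arbitrary ι
    have hi := h i i
    rw [hc, hD] at hi
    simp only [Matrix.trace_smul, Matrix.trace_one, Matrix.smul_apply, Matrix.one_apply_eq,
      smul_eq_mul, mul_one] at hi
    exact mul_left_cancel₀ hn (by linear_combination hi)
  refine ⟨(star c).im, hD.trans ?_⟩
  congr 1
  have := congrArg Complex.re hre
  apply Complex.ext <;> simp at this ⊢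
  linarith

/-- If two representations `{K, V_k}` and `{K', V'_k}` with all `V_k, V'_k`
traceless define the same generator `X ↦ Σ_k V_k X V_k* − KX − XK*`, then `K' = K + iλ𝟙` for
some real `λ`, and the completely positive parts agree: `Σ_k V_k X V_k* = Σ_k V'_k X V'_k*`
for all `X`. -/
theorem traceless_representation_rigidity {n r s : ℕ}
    (K K' : Matrix (Fin n) (Fin n) ℂ)
    (V : Fin r → Matrix (Fin n) (Fin n) ℂ) (V' : Fin s → Matrix (Fin n) (Fin n) ℂ)
    (htrV : ∀ k, (V k).trace = 0) (htrV' : ∀ k, (V' k).trace = 0)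
    (heq : ∀ X : Matrix (Fin n) (Fin n) ℂ,
      (∑ k, V k * X * (V k)ᴴ) - K * X - X * Kᴴ =
      (∑ k, V' k * X * (V' k)ᴴ) - K' * X - X * K'ᴴ) :
    (∃ lam : ℝ, K' = K + ((lam : ℂ) * Complex.I) • (1 : Matrix (Fin n) (Fin n) ℂ)) ∧
    (∀ X : Matrix (Fin n) (Fin n) ℂ, (∑ k, V k * X * (V k)ᴴ) = ∑ k, V' k * X * (V' k)ᴴ) := by
  have hK : ∃ lam : ℝ, K' = K + ((lam : ℂ) * Complex.I) • (1 : Matrix (Fin n) (Fin n) ℂ) := by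
    obtain ⟨lam, hlam⟩ := Matrix.exists_eq_imaginary_smul_one (K' - K) fun b q => by
      have h := Matrix.sum_generator_single_apply K V htrV b q
      simp only [heq, Matrix.sum_generator_single_apply K' V' htrV' b q] at h
      rw [Matrix.trace_sub, Matrix.conjTranspose_sub, Matrix.sub_apply]
      linear_combination -h
    exact ⟨lam, by rw [← hlam]; abel⟩
  refine ⟨hK, fun X => ?_⟩
  obtain ⟨lam, rfl⟩ := hK
  have hdrift : (K + ((lam : ℂ) * Complex.I) • (1 : Matrix (Fin n) (Fin n) ℂ)) * X +
      X * (K + ((lam : ℂ) * Complex.I) • (1 : Matrix (Fin n) (Fin n) ℂ))ᴴ = K * X + X * Kᴴ := by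
    simp [Matrix.add_mul, Matrix.mul_add]
    abel
  have h := heq X
  rw [sub_sub, sub_sub, hdrift] at h
  exact sub_left_injective h
end
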